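/- arXiv:1907.00470 — 9 statements merged into one kernel-verified Lean document; each statement's English description precedes it below -/
import Mathlib

section
/- Let A be a type, k ≥ 1, and let d₀, …, d_k : A⁴ → A be a distributivity sequence of length k. Let α, β, γ be equivalence relations on A, each compatible with every d_i. Then α ∩ (β ∘ γ ∘ β) ⊆ (α ∩ β) ∘_k γ. -/
/-- Relational composition: `RComp ρ σ a c` iff there is `b` with `ρ a b` and `σ b c`. -/
def RComp {A : Type*} (ρ σ : A → A → Prop) : A → A → Prop :=
  fun a c => ∃ b, ρ a b ∧ σ b c

/-- Alternating composition `ρ ∘_h σ` with `h` factors, starting with `ρ`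
(the value at `0` is irrelevant; the notion is used for `h ≥ 1`). -/
def AltComp {A : Type*} (ρ σ : A → A → Prop) : ℕ → (A → A → Prop)
  | 0 => ρ
  | 1 => ρ
  | (n+2) => RComp ρ (AltComp σ ρ (n+1))

/-- Intersection of binary relations. -/
def RInter {A : Type*} (ρ σ : A → A → Prop) : A → A → Prop :=
  fun a b => ρ a b ∧ σ a b

/-- Converse of a binary relation. -/
def RConv {A : Type*} (ρ : A → A → Prop) : A → A → Prop :=
  fun a b => ρ b a

/-- A binary relation `θ` is compatible with a 4-ary operation `f`. -/
def Compat4 {A : Type*} (θ : A → A → Prop) (f : A → A → A → A → A) : Prop :=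
  ∀ a₁ a₂ a₃ a₄ b₁ b₂ b₃ b₄, θ a₁ b₁ → θ a₂ b₂ → θ a₃ b₃ → θ a₄ b₄ →
    θ (f a₁ a₂ a₃ a₄) (f b₁ b₂ b₃ b₄)

/-- `d 0, …, d k` is a distributivity sequence of length `k`. -/
def IsDistribSeq {A : Type*} (k : ℕ) (d : ℕ → A → A → A → A → A) : Prop :=
  (∀ x y z w, d 0 x y z w = x) ∧
  (∀ i, i < k → Even i → ∀ x w, d i x x w w = d (i+1) x x w w) ∧
  (∀ i, i < k → Even i → ∀ x y z, d i x y z x = d (i+1) x y z x) ∧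
  (∀ i, i < k → Odd i → ∀ x y w, d i x y y w = d (i+1) x y y w) ∧
  (∀ x y z w, d k x y z w = w)

theorem AltComp.of_chain {A : Type*} (n : ℕ) (ρ σ : A → A → Prop) (x : ℕ → A)
    (hρ : ∀ i < n + 1, Even i → ρ (x i) (x (i + 1)))
    (hσ : ∀ i < n + 1, Odd i → σ (x i) (x (i + 1))) :
    AltComp ρ σ (n + 1) (x 0) (x (n + 1)) := by
  induction n generalizing ρ σ x with
  | zero => exact hρ 0 (by omega) Even.zero
  | succ n ih =>
    refine ⟨x 1, hρ 0 (by omega) Even.zero, ih σ ρ (fun i => x (i + 1)) ?_ ?_⟩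
    · exact fun i hi h => hσ (i + 1) (by omega) h.add_one
    · exact fun i hi h => hρ (i + 1) (by omega) h.add_one

/-- If a variety (here: a type with a distributivity sequence of length `k ≥ 1` for
which `α`, `β`, `γ` are compatible equivalence relations) has such terms, then
`α ∩ (β ∘ γ ∘ β) ⊆ (α ∩ β) ∘_k γ`. -/
theorem stmt0 {A : Type*} (k : ℕ) (hk : 1 ≤ k) (d : ℕ → A → A → A → A → A)
    (hd : IsDistribSeq k d) (α β γ : A → A → Prop)
    (hα : Equivalence α) (hβ : Equivalence β) (hγ : Equivalence γ)
    (hcα : ∀ i ≤ k, Compat4 α (d i)) (hcβ : ∀ i ≤ k, Compat4 β (d i))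
    (hcγ : ∀ i ≤ k, Compat4 γ (d i)) :
    ∀ a e : A, α a e → RComp β (RComp γ β) a e →
      AltComp (RInter α β) γ k a e := by
  obtain ⟨h0, hβd, hαd, hγd, hk'⟩ := hd
  rintro a e hae ⟨b, hab, c, hbc, hce⟩
  obtain ⟨n, rfl⟩ : ∃ n, k = n + 1 := ⟨k - 1, by omega⟩
  have key := AltComp.of_chain n (RInter α β) γ (fun i => d i a b c e) ?_ ?_
  · simpa only [h0, hk'] using key
  · intro i hi hev
    constructor
    · have h1 := hcα i (by omega) a b c e a b c a
        (hα.refl a) (hα.refl b) (hα.refl c) (hα.symm hae)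
      have h2 := hcα (i + 1) (by omega) a b c a a b c e
        (hα.refl a) (hα.refl b) (hα.refl c) hae
      rw [hαd i hi hev] at h1
      exact hα.trans h1 h2
    · have h1 := hcβ i (by omega) a b c e a a e e
        (hβ.refl a) (hβ.symm hab) hce (hβ.refl e)
      have h2 := hcβ (i + 1) (by omega) a a e e a b c e
        (hβ.refl a) hab (hβ.symm hce) (hβ.refl e)
      rw [hβd i hi hev] at h1
      exact hβ.trans h1 h2
  · intro i hi hodd
    have h1 := hcγ i (by omega) a b c e a b b e
      (hγ.refl a) (hγ.refl b) (hγ.symm hbc) (hγ.refl e)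
    have h2 := hcγ (i + 1) (by omega) a b b e a b c e
      (hγ.refl a) (hγ.refl b) hbc (hγ.refl e)
    rw [hγd i hi hodd] at h1
    exact hγ.trans h1 h2
end

section
/- Let A be a type, k ≥ 1, and let d₀, …, d_k : A⁴ → A be a distributivity sequence of length k. Then d_i(x,y,y,x) = x for every i ≤ k and all x, y ∈ A. Consequently d₀, …, d_k satisfy Day's conditions for congruence modularity: d₀(x,y,z,w) = x, d_k(x,y,z,w) = w, d_i(x,y,y,x) = x for all i ≤ k, d_i(x,x,w,w) = d_{i+1}(x,x,w,w) for even i < k, and d_i(x,y,y,w) = d_{i+1}(x,y,y,w) for odd i < k. -/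
/-- A distributivity sequence satisfies `d i x y y x = x` for all `i ≤ k`, and hence
satisfies Day's conditions for congruence modularity. -/
theorem stmt1 {A : Type*} (k : ℕ) (hk : 1 ≤ k) (d : ℕ → A → A → A → A → A)
    (hd : IsDistribSeq k d) :
    (∀ i ≤ k, ∀ x y : A, d i x y y x = x) ∧
    (∀ x y z w : A, d 0 x y z w = x) ∧
    (∀ x y z w : A, d k x y z w = w) ∧
    (∀ i, i < k → Even i → ∀ x w : A, d i x x w w = d (i+1) x x w w) ∧
    (∀ i, i < k → Odd i → ∀ x y w : A, d i x y y w = d (i+1) x y y w) := by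
  obtain ⟨hzero, hpair, hends, hmid, hlast⟩ := hd
  refine ⟨fun i hi x y => ?_, hzero, hlast, hpair, hmid⟩
  induction i with
  | zero => exact hzero x y y x
  | succ i ih =>
    have hik : i < k := hi
    rcases Nat.even_or_odd i with h | h
    · rw [← hends i hik h x y y, ih hik.le]
    · rw [← hmid i hik h x y x, ih hik.le]
end

section
/- Let A be a type, let k ≥ 3 be odd, and let d₀, …, d_k : A⁴ → A be a distributivity sequence of length k. Let α, β, γ be equivalence relations on A, each compatible with every d_i. Then α ∩ (β ∘ γ ∘ β) ⊆ (α ∩ β) ∘_r (α ∩ γ), where r = (k² − 4k + 9)/2. -/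
section AltComp

variable {A : Type*} {ρ σ : A → A → Prop}

theorem AltComp.of_seq (h : ℕ) : ∀ {ρ σ : A → A → Prop} (s : ℕ → A),
    (∀ i ≤ h, Even i → ρ (s i) (s (i + 1))) → (∀ i ≤ h, Odd i → σ (s i) (s (i + 1))) →
    AltComp ρ σ (h + 1) (s 0) (s (h + 1)) := by
  induction h with
  | zero => exact fun s hs _ => hs 0 le_rfl Even.zero
  | succ h ih =>
    intro ρ σ s hs ht
    exact ⟨s 1, hs 0 (Nat.zero_le _) Even.zero, ih (fun i => s (i + 1))
      (fun i hi he => ht (i + 1) (by omega) he.add_one)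
      (fun i hi ho => hs (i + 1) (by omega) ho.add_one)⟩

theorem AltComp.cons_same (hρ : ∀ x y z, ρ x y → ρ y z → ρ x z) {n : ℕ} {a b c : A}
    (hab : ρ a b) (hbc : AltComp ρ σ (n + 1) b c) : AltComp ρ σ (n + 1) a c := by
  cases n with
  | zero => exact hρ _ _ _ hab hbc
  | succ n =>
    obtain ⟨x, hx, hxc⟩ := hbc
    exact ⟨x, hρ _ _ _ hab hx, hxc⟩

theorem AltComp.odd_trans (hρ : ∀ x y z, ρ x y → ρ y z → ρ x z) {m n : ℕ} {a b c : A}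
    (hab : AltComp ρ σ (2 * m + 1) a b) (hbc : AltComp ρ σ (2 * n + 1) b c) :
    AltComp ρ σ (2 * (m + n) + 1) a c := by
  induction m generalizing a with
  | zero => simpa using AltComp.cons_same hρ hab hbc
  | succ m ih =>
    obtain ⟨x, hx, y, hy, h⟩ := hab
    rw [show 2 * (m + 1 + n) + 1 = 2 * (m + n) + 1 + 2 by ring]
    exact ⟨x, hx, y, hy, ih h⟩

theorem AltComp.odd_snoc {m : ℕ} {a b c : A}
    (hab : AltComp ρ σ (2 * m + 1) a b) (hbc : σ b c) : AltComp ρ σ (2 * m + 2) a c := by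
  induction m generalizing a with
  | zero => exact ⟨b, hab, hbc⟩
  | succ m ih =>
    obtain ⟨x, hx, y, hy, h⟩ := hab
    exact ⟨x, hx, y, hy, ih h⟩

end AltComp

section IsDistribSeq

variable {A : Type*} {k : ℕ} {d : ℕ → A → A → A → A → A} {α β γ : A → A → Prop}

theorem RInter.trans (hα : Equivalence α) (hβ : Equivalence β) (x y z : A)
    (hxy : RInter α β x y) (hyz : RInter α β y z) : RInter α β x z :=
  ⟨hα.trans hxy.1 hyz.1, hβ.trans hxy.2 hyz.2⟩

theorem IsDistribSeq.apply_middle_eq (hd : IsDistribSeq k d) (x y : A) :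
    ∀ i ≤ k, d i x y y x = x := by
  intro i
  induction i with
  | zero => exact fun _ => hd.1 _ _ _ _
  | succ i ih =>
    intro hi
    rcases Nat.even_or_odd i with he | ho
    · rw [← hd.2.2.1 i hi he, ih (by omega)]
    · rw [← hd.2.2.2.1 i hi ho, ih (by omega)]

theorem IsDistribSeq.rel_apply_middle (hd : IsDistribSeq k d) (hα : Equivalence α)
    (hcα : ∀ i ≤ k, Compat4 α (d i)) {u z : A} (huz : α u z) (p : A) {i : ℕ} (hi : i ≤ k) :
    α u (d i u p p z) := by
  have h := hcα i hi u p p u u p p z (hα.refl _) (hα.refl _) (hα.refl _) huz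
  rwa [hd.apply_middle_eq u p i hi] at h

theorem IsDistribSeq.rel_even_step (hd : IsDistribSeq k d) (hα : Equivalence α)
    (hcα : ∀ i ≤ k, Compat4 α (d i)) {u z : A} (huz : α u z) (p q : A) {i : ℕ} (hi : i < k)
    (he : Even i) : α (d i u p q z) (d (i + 1) u p q z) := by
  have h₀ := hcα i hi.le u p q u u p q z (hα.refl _) (hα.refl _) (hα.refl _) huz
  have h₁ := hcα (i + 1) hi u p q u u p q z (hα.refl _) (hα.refl _) (hα.refl _) huz
  rw [hd.2.2.1 i hi he] at h₀
  exact hα.trans (hα.symm h₀) h₁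

theorem IsDistribSeq.rel_even_step_of_ends (hd : IsDistribSeq k d) (hβ : Equivalence β)
    (hcβ : ∀ i ≤ k, Compat4 β (d i)) {u p q z : A} (hup : β u p) (hqz : β q z) {i : ℕ}
    (hi : i < k) (he : Even i) : β (d i u p q z) (d (i + 1) u p q z) := by
  have h₀ := hcβ i hi.le u u z z u p q z (hβ.refl _) hup (hβ.symm hqz) (hβ.refl _)
  have h₁ := hcβ (i + 1) hi u u z z u p q z (hβ.refl _) hup (hβ.symm hqz) (hβ.refl _)
  rw [hd.2.1 i hi he] at h₀
  exact hβ.trans (hβ.symm h₀) h₁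

theorem IsDistribSeq.rel_odd_step (hd : IsDistribSeq k d) (hγ : Equivalence γ)
    (hcγ : ∀ i ≤ k, Compat4 γ (d i)) {p q : A} (u z : A) (hpq : γ p q) {i : ℕ}
    (hi : i < k) (ho : Odd i) : γ (d i u p q z) (d (i + 1) u p q z) := by
  have h₀ := hcγ i hi.le u p p z u p q z (hγ.refl _) (hγ.refl _) hpq (hγ.refl _)
  have h₁ := hcγ (i + 1) hi u p p z u p q z (hγ.refl _) (hγ.refl _) hpq (hγ.refl _)
  rw [hd.2.2.2.1 i hi ho] at h₀
  exact hγ.trans (hγ.symm h₀) h₁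

/-- `α ∩ (γ ∘ (α ∩ β) ∘ γ) ⊆ (α ∩ γ) ∘_k (α ∩ β)`. -/
theorem IsDistribSeq.altComp_of_rel (hd : IsDistribSeq k d) (hk : k ≠ 0)
    (hα : Equivalence α) (hβ : Equivalence β) (hγ : Equivalence γ)
    (hcα : ∀ i ≤ k, Compat4 α (d i)) (hcβ : ∀ i ≤ k, Compat4 β (d i))
    (hcγ : ∀ i ≤ k, Compat4 γ (d i)) {u v w z : A} (huz : α u z) (huv : γ u v)
    (hvw : RInter α β v w) (hwz : γ w z) :
    AltComp (RInter α γ) (RInter α β) k u z := by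
  obtain ⟨n, rfl⟩ := Nat.exists_eq_succ_of_ne_zero hk
  have h := AltComp.of_seq (ρ := RInter α γ) (σ := RInter α β) n (fun i => d i u v w z)
    (fun i hi he => ⟨hd.rel_even_step hα hcα huz v w (by omega) he,
      hd.rel_even_step_of_ends hγ hcγ huv hwz (by omega) he⟩)
    (fun i hi ho => ⟨hd.rel_odd_step hα hcα u z hvw.1 (by omega) ho,
      hd.rel_odd_step hβ hcβ u z hvw.2 (by omega) ho⟩)
  simpa only [hd.1, hd.2.2.2.2] using h

end IsDistribSeq

/-- For odd `k ≥ 3`, a distributivity sequence of length `k` yields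
`α ∩ (β ∘ γ ∘ β) ⊆ (α ∩ β) ∘_r (α ∩ γ)` with `r = (k² − 4k + 9)/2`
(expressed subtraction-free as `2r + 4k = k² + 9`). -/
theorem stmt2 {A : Type*} (k : ℕ) (hk : 3 ≤ k) (hkodd : Odd k)
    (r : ℕ) (hr : 2 * r + 4 * k = k ^ 2 + 9)
    (d : ℕ → A → A → A → A → A) (hd : IsDistribSeq k d)
    (α β γ : A → A → Prop)
    (hα : Equivalence α) (hβ : Equivalence β) (hγ : Equivalence γ)
    (hcα : ∀ i ≤ k, Compat4 α (d i)) (hcβ : ∀ i ≤ k, Compat4 β (d i))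
    (hcγ : ∀ i ≤ k, Compat4 γ (d i)) :
    ∀ a e : A, α a e → RComp β (RComp γ β) a e →
      AltComp (RInter α β) (RInter α γ) r a e := by
  rintro a e hae ⟨b, hab, c, hbc, hce⟩
  obtain ⟨m, rfl⟩ := hkodd
  obtain ⟨n, rfl⟩ : ∃ n, m = n + 1 := ⟨m - 1, by omega⟩
  have hr' : r = 2 * ((n + 1) * n) + 1 + 2 := by nlinarith
  have hmid : ∀ {i}, i ≤ 2 * (n + 1) + 1 → α a (d i a b b e) :=
    fun hi => hd.rel_apply_middle hα hcα hae b hi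
  have hγmid : ∀ {i}, i ≤ 2 * (n + 1) + 1 → γ (d i a b b e) (d i a b c e) :=
    fun hi => hcγ _ hi _ _ _ _ _ _ _ _ (hγ.refl _) (hγ.refl _) hbc (hγ.refl _)
  have hαβ : ∀ {i}, i < 2 * (n + 1) + 1 → Even i →
      RInter α β (d i a b c e) (d (i + 1) a b c e) :=
    fun hi he => ⟨hd.rel_even_step hα hcα hae b c hi he,
      hd.rel_even_step_of_ends hβ hcβ hab hce hi he⟩
  have hfirst := hαβ (i := 0) (by omega) Even.zero
  have hlast := hαβ (i := 2 * (n + 1)) (by omega) (even_two_mul _)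
  rw [hd.1] at hfirst
  rw [hd.2.2.2.2] at hlast
  have htrans := RInter.trans hα hγ
  have hpath : ∀ j ≤ n, AltComp (RInter α γ) (RInter α β) (2 * ((n + 1) * j) + 1)
      (d 1 a b c e) (d (2 * (j + 1)) a b b e) := by
    intro j
    induction j with
    | zero =>
      intro _
      have h := hd.2.2.2.1 1 (by omega) odd_one a b e
      refine ⟨hα.trans (hα.symm hfirst.1) (hmid (by omega)), ?_⟩
      simp only [zero_add, mul_one]
      rw [← h]
      exact hγ.symm (hγmid (by omega))
    | succ j ih =>
      intro hj
      have ho : d (2 * (j + 1) + 1) a b b e = d (2 * (j + 1 + 1)) a b b e :=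
        hd.2.2.2.1 (2 * (j + 1) + 1) (by omega) (odd_two_mul_add_one _) a b e
      rw [mul_add_one, ← ho]
      exact (ih (by omega)).odd_trans htrans
        (hd.altComp_of_rel (by omega) hα hβ hγ hcα hcβ hcγ
          (hα.trans (hα.symm (hmid (by omega))) (hmid (by omega)))
          (hγmid (by omega)) (hαβ (by omega) (even_two_mul _)) (hγ.symm (hγmid (by omega))))
  have hend : RInter α γ (d (2 * (n + 1)) a b b e) (d (2 * (n + 1)) a b c e) :=
    ⟨hα.trans (hα.symm (hmid (by omega))) (hα.trans hae (hα.symm hlast.1)), hγmid (by omega)⟩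
  have hmain := ((hpath n le_rfl).odd_trans htrans (n := 0) hend).odd_snoc hlast
  rw [hr']
  exact ⟨_, hfirst, hmain⟩
end

section
/- Let A be a type, k ≥ 3, and let d₀, …, d_k : A⁴ → A be a distributivity sequence of length k. Let α, β, γ be equivalence relations on A, each compatible with every d_i. Suppose a, b, c, d ∈ A satisfy (a,d) ∈ α, (a,b) ∈ β, (b,c) ∈ γ, and (c,d) ∈ β. Then for every odd index i with i + 2 ≤ k, the pair (d_i(a,b,b,d), d_{i+2}(a,b,b,d)) belongs to α ∩ (γ ∘ (α ∩ β) ∘ γ). -/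
/-- With `a α d`, `a β b γ c β d`, for every odd `i` with `i + 2 ≤ k` the pair
`(d_i(a,b,b,d), d_{i+2}(a,b,b,d))` lies in `α ∩ (γ ∘ (α ∩ β) ∘ γ)`. -/
theorem stmt4 {A : Type*} (k : ℕ) (hk : 3 ≤ k) (d : ℕ → A → A → A → A → A)
    (hd : IsDistribSeq k d) (α β γ : A → A → Prop)
    (hα : Equivalence α) (hβ : Equivalence β) (hγ : Equivalence γ)
    (hcα : ∀ i ≤ k, Compat4 α (d i)) (hcβ : ∀ i ≤ k, Compat4 β (d i))
    (hcγ : ∀ i ≤ k, Compat4 γ (d i))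
    (a b c e : A) (had : α a e) (hab : β a b) (hbc : γ b c) (hcd : β c e) :
    ∀ i, Odd i → i + 2 ≤ k →
      RInter α (RComp γ (RComp (RInter α β) γ))
        (d i a b b e) (d (i+2) a b b e) := by
  obtain ⟨-, heq, hends, hmid, -⟩ := hd
  intro i hi hik
  have hj : Even (i + 1) := hi.add_one
  have hα_step : ∀ y z, α (d (i+1) a y z e) (d (i+2) a y z e) := by
    intro y z
    have h₁ : α (d (i+1) a y z e) (d (i+1) a y z a) :=
      hcα _ (by omega) _ _ _ _ _ _ _ _ (hα.refl a) (hα.refl y) (hα.refl z) (hα.symm had)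
    have h₂ : α (d (i+2) a y z a) (d (i+2) a y z e) :=
      hcα _ hik _ _ _ _ _ _ _ _ (hα.refl a) (hα.refl y) (hα.refl z) had
    rw [hends (i+1) (by omega) hj] at h₁
    exact hα.trans h₁ h₂
  have hβ_step : β (d (i+1) a b c e) (d (i+2) a b c e) := by
    have h₁ : β (d (i+1) a b c e) (d (i+1) a a e e) :=
      hcβ _ (by omega) _ _ _ _ _ _ _ _ (hβ.refl a) (hβ.symm hab) hcd (hβ.refl e)
    have h₂ : β (d (i+2) a a e e) (d (i+2) a b c e) :=
      hcβ _ hik _ _ _ _ _ _ _ _ (hβ.refl a) hab (hβ.symm hcd) (hβ.refl e)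
    rw [heq (i+1) (by omega) hj] at h₁
    exact hβ.trans h₁ h₂
  rw [hmid i (by omega) hi]
  refine ⟨hα_step b b, d (i+1) a b c e, ?_, d (i+2) a b c e, ⟨hα_step b c, hβ_step⟩, ?_⟩
  · exact hcγ _ (by omega) _ _ _ _ _ _ _ _ (hγ.refl a) (hγ.refl b) hbc (hγ.refl e)
  · exact hcγ _ hik _ _ _ _ _ _ _ _ (hγ.refl a) (hγ.refl b) (hγ.symm hbc) (hγ.refl e)
end

section
/- Let A be a type, let k ≥ 2 be even, and let d₀, …, d_k : A⁴ → A be a distributivity sequence of length k. Let α, β, γ be equivalence relations on A, each compatible with every d_i. Then α ∩ (β ∘ γ ∘ β) ⊆ γ ∘_k (α ∩ β). -/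
/-- A chain whose steps lie alternately in `ρ` and `σ` witnesses an alternating composition. -/
theorem altComp_of_chain {A : Type*} (n : ℕ) (ρ σ : A → A → Prop) (f : ℕ → A)
    (heven : ∀ j ≤ n, Even j → ρ (f j) (f (j + 1)))
    (hodd : ∀ j ≤ n, Odd j → σ (f j) (f (j + 1))) :
    AltComp ρ σ (n + 1) (f 0) (f (n + 1)) := by
  induction n generalizing ρ σ f with
  | zero => exact heven 0 le_rfl Even.zero
  | succ n ih =>
    exact ⟨f 1, heven 0 (Nat.zero_le _) Even.zero,
      ih σ ρ (fun j => f (j + 1)) (fun j hj h => hodd (j + 1) (by lia) h.add_one)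
        (fun j hj h => heven (j + 1) (by lia) h.add_one)⟩

/-- For even `k ≥ 2`, a distributivity sequence of length `k` yields
`α ∩ (β ∘ γ ∘ β) ⊆ γ ∘_k (α ∩ β)`. -/
theorem stmt5 {A : Type*} (k : ℕ) (hk : 2 ≤ k) (hkeven : Even k)
    (d : ℕ → A → A → A → A → A) (hd : IsDistribSeq k d)
    (α β γ : A → A → Prop)
    (hα : Equivalence α) (hβ : Equivalence β) (hγ : Equivalence γ)
    (hcα : ∀ i ≤ k, Compat4 α (d i)) (hcβ : ∀ i ≤ k, Compat4 β (d i))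
    (hcγ : ∀ i ≤ k, Compat4 γ (d i)) :
    ∀ a e : A, α a e → RComp β (RComp γ β) a e →
      AltComp γ (RInter α β) k a e := by
  rintro a e hae ⟨b, hab, c, hbc, hce⟩
  obtain ⟨h0, hpair, hends, hmid, hlast⟩ := hd
  have hγ_step : ∀ i < k, Odd i → γ (d (i + 1) e c b a) (d i e c b a) := by
    intro i hi ho
    have h₁ := hcγ i hi.le _ _ _ _ _ _ _ _ (hγ.refl e) (hγ.refl c) hbc (hγ.refl a)
    have h₂ := hcγ (i + 1) hi _ _ _ _ _ _ _ _ (hγ.refl e) (hγ.refl c) hbc (hγ.refl a)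
    rw [hmid i hi ho] at h₁
    exact hγ.trans h₂ (hγ.symm h₁)
  have hα_step : ∀ i < k, Even i → α (d (i + 1) e c b a) (d i e c b a) := by
    intro i hi he
    have h₁ := hcα i hi.le _ _ _ _ _ _ _ _ (hα.refl e) (hα.refl c) (hα.refl b) hae
    have h₂ := hcα (i + 1) hi _ _ _ _ _ _ _ _ (hα.refl e) (hα.refl c) (hα.refl b) hae
    rw [hends i hi he] at h₁
    exact hα.trans h₂ (hα.symm h₁)
  have hβ_step : ∀ i < k, Even i → β (d (i + 1) e c b a) (d i e c b a) := by
    intro i hi he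
    have h₁ := hcβ i hi.le _ _ _ _ _ _ _ _ (hβ.refl e) hce (hβ.symm hab) (hβ.refl a)
    have h₂ := hcβ (i + 1) hi _ _ _ _ _ _ _ _ (hβ.refl e) hce (hβ.symm hab) (hβ.refl a)
    rw [hpair i hi he] at h₁
    exact hβ.trans h₂ (hβ.symm h₁)
  obtain ⟨n, rfl⟩ : ∃ n, k = n + 1 := ⟨k - 1, by lia⟩
  have hchain := altComp_of_chain n γ (RInter α β) (fun j => d (n + 1 - j) e c b a)
    (fun j hj h => by
      have hstep := hγ_step (n - j) (by lia) (by grind)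
      rw [← Nat.sub_add_comm hj] at hstep
      simpa only [Nat.add_sub_add_right] using hstep)
    (fun j hj h => by
      have hparity : Even (n - j) := by grind
      have hstep : RInter α β (d (n - j + 1) e c b a) (d (n - j) e c b a) :=
        ⟨hα_step _ (by lia) hparity, hβ_step _ (by lia) hparity⟩
      rw [← Nat.sub_add_comm hj] at hstep
      simpa only [Nat.add_sub_add_right] using hstep)
  simpa only [Nat.sub_zero, Nat.sub_self, h0, hlast] using hchain
end

section
/- Let A be a type, let β and γ be equivalence relations on A, and let ℓ ≥ 2. Set R = β ∘_{2^{ℓ−1}} γ (the alternating composition with 2^{ℓ−1} factors, starting with β). Then β ∘_{2^ℓ − 1} γ = R ∘ R⁻¹. -/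
theorem RComp_assoc {A : Type*} (ρ σ τ : A → A → Prop) :
    RComp (RComp ρ σ) τ = RComp ρ (RComp σ τ) := by
  funext a c
  apply propext
  constructor
  · rintro ⟨b, ⟨d, h₁, h₂⟩, h₃⟩
    exact ⟨d, h₁, b, h₂, h₃⟩
  · rintro ⟨d, h₁, b, h₂, h₃⟩
    exact ⟨b, ⟨d, h₁, h₂⟩, h₃⟩

theorem RConv_RComp {A : Type*} (ρ σ : A → A → Prop) :
    RConv (RComp ρ σ) = RComp (RConv σ) (RConv ρ) := by
  funext a c
  exact propext ⟨fun ⟨b, h₁, h₂⟩ => ⟨b, h₂, h₁⟩, fun ⟨b, h₁, h₂⟩ => ⟨b, h₂, h₁⟩⟩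

theorem RConv_eq_of_equivalence {A : Type*} {ρ : A → A → Prop} (h : Equivalence ρ) :
    RConv ρ = ρ := by
  funext a b
  exact propext ⟨h.symm, h.symm⟩

theorem RComp_self_of_equivalence {A : Type*} {ρ : A → A → Prop} (h : Equivalence ρ) :
    RComp ρ ρ = ρ := by
  funext a b
  exact propext ⟨fun ⟨_, h₁, h₂⟩ => h.trans h₁ h₂, fun h₁ => ⟨a, h.refl a, h₁⟩⟩

theorem AltComp_add_two {A : Type*} (ρ σ : A → A → Prop) (n : ℕ) :
    AltComp ρ σ (n + 2) = RComp ρ (AltComp σ ρ (n + 1)) := rfl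

/-- An alternating composition with an even number of factors splits off its last factor. -/
theorem AltComp_even_eq_RComp {A : Type*} (ρ σ : A → A → Prop) (n : ℕ) :
    AltComp ρ σ (2 * n + 2) = RComp (AltComp ρ σ (2 * n + 1)) σ := by
  induction n with
  | zero => rfl
  | succ n ih =>
    change RComp ρ (RComp σ (AltComp ρ σ (2 * n + 2))) =
      RComp (RComp ρ (RComp σ (AltComp ρ σ (2 * n + 1)))) σ
    rw [ih, RComp_assoc, RComp_assoc]

/-- Composing an alternating composition of `n + 1` equivalence relations with its converse
merges the two middle factors. -/
theorem AltComp_odd_eq_RComp_RConv {A : Type*} (n : ℕ) {ρ σ : A → A → Prop}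
    (hρ : Equivalence ρ) (hσ : Equivalence σ) :
    AltComp ρ σ (2 * n + 1) = RComp (AltComp ρ σ (n + 1)) (RConv (AltComp ρ σ (n + 1))) := by
  induction n generalizing ρ σ with
  | zero =>
    change ρ = RComp ρ (RConv ρ)
    rw [RConv_eq_of_equivalence hρ, RComp_self_of_equivalence hρ]
  | succ n ih =>
    change RComp ρ (AltComp σ ρ (2 * n + 2)) = _
    rw [AltComp_even_eq_RComp, ih hσ hρ, AltComp_add_two, RConv_RComp,
      RConv_eq_of_equivalence hρ, RComp_assoc, RComp_assoc]

/-- For equivalence relations `β, γ` and `ℓ ≥ 2`, setting `R = β ∘_{2^{ℓ−1}} γ`,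
one has `β ∘_{2^ℓ − 1} γ = R ∘ R⁻¹`. -/
theorem stmt8 {A : Type*} (β γ : A → A → Prop)
    (hβ : Equivalence β) (hγ : Equivalence γ) (ℓ : ℕ) (hℓ : 2 ≤ ℓ) :
    AltComp β γ (2 ^ ℓ - 1) =
      RComp (AltComp β γ (2 ^ (ℓ - 1))) (RConv (AltComp β γ (2 ^ (ℓ - 1)))) := by
  obtain ⟨m, rfl⟩ : ∃ m, ℓ = m + 1 := ⟨ℓ - 1, by omega⟩
  obtain ⟨n, hn⟩ : ∃ n, 2 ^ m = n + 1 := ⟨2 ^ m - 1, by have := Nat.two_pow_pos m; omega⟩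
  have h : 2 ^ (m + 1) - 1 = 2 * n + 1 := by rw [pow_succ]; omega
  rw [h, Nat.add_sub_cancel, hn]
  exact AltComp_odd_eq_RComp_RConv n hβ hγ
end

section
/- Let A be a type, let r ≥ 1, set k = 2r, and let d₀, …, d_k : A⁴ → A be a distributivity sequence of length k. Let α, β, γ be equivalence relations on A, each compatible with every d_i. Then for every ℓ ≥ 2: α ∩ (β ∘_{2^ℓ − 1} γ) ⊆ (α ∩ β) ∘_{2·r^{ℓ−1}} γ. -/
theorem altComp_odd_add_iff {A : Type*} {ρ σ : A → A → Prop} (m k : ℕ) (a c : A) :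
    AltComp ρ σ (2 * m + 1 + (k + 1)) a c ↔
      ∃ b, AltComp ρ σ (2 * m + 1) a b ∧ AltComp σ ρ (k + 1) b c := by
  induction m generalizing a with
  | zero =>
    rw [show 2 * 0 + 1 + (k + 1) = k + 2 by omega]
    exact Iff.rfl
  | succ m ih =>
    rw [show 2 * (m + 1) + 1 + (k + 1) = 2 * m + 1 + k + 1 + 2 by omega,
      show 2 * (m + 1) + 1 = 2 * m + 1 + 2 by omega]
    constructor
    · rintro ⟨x, hx, y, hy, h⟩
      obtain ⟨b, h₁, h₂⟩ := (ih y).1 h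
      exact ⟨b, ⟨x, hx, y, hy, h₁⟩, h₂⟩
    · rintro ⟨b, ⟨x, hx, y, hy, h₁⟩, h₂⟩
      exact ⟨x, hx, y, hy, (ih y).2 ⟨b, h₁, h₂⟩⟩

theorem AltComp.even_add {A : Type*} {ρ σ : A → A → Prop} {m k : ℕ} {a b c : A}
    (h₁ : AltComp ρ σ (2 * m + 2) a b) (h₂ : AltComp ρ σ (k + 1) b c) :
    AltComp ρ σ (2 * m + 2 + (k + 1)) a c := by
  obtain ⟨x, hx, hxb⟩ := (altComp_odd_add_iff m 0 a b).1 h₁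
  rw [show 2 * m + 2 + (k + 1) = 2 * m + 1 + (k + 1 + 1) by omega]
  exact (altComp_odd_add_iff m (k + 1) a c).2 ⟨x, hx, b, hxb, h₂⟩

theorem AltComp.even_trans_right {A : Type*} {ρ σ : A → A → Prop} (hσ : Equivalence σ)
    {m : ℕ} {a b c : A} (h₁ : AltComp ρ σ (2 * m + 2) a b) (h₂ : σ b c) :
    AltComp ρ σ (2 * m + 2) a c := by
  obtain ⟨x, hx, hxb⟩ := (altComp_odd_add_iff m 0 a b).1 h₁
  exact (altComp_odd_add_iff m 0 a c).2 ⟨x, hx, hσ.trans hxb h₂⟩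

/-- Two alternating chains of odd length can be folded at their middle links: if `f` and `g`
agree on tuples `(x, x, w, w)`, their values at the end points are related by a chain of the
same length. -/
theorem altComp_fold {A : Type*} {ρ σ : A → A → Prop} (hρ : Equivalence ρ) (hσ : Equivalence σ)
    {f g : A → A → A → A → A} (hfg : ∀ x w, f x x w w = g x x w w)
    (hfρ : Compat4 ρ f) (hgρ : Compat4 ρ g) (hfσ : Compat4 σ f) (hgσ : Compat4 σ g)
    (m : ℕ) {a b c e : A} (hab : AltComp ρ σ (2 * m + 1) a b)
    (hce : AltComp ρ σ (2 * m + 1) c e) :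
    AltComp ρ σ (2 * m + 1) (f a b c e) (g a b c e) := by
  induction m generalizing ρ σ a b c e with
  | zero =>
    have h₁ : ρ (f a b c e) (f a a e e) :=
      hfρ _ _ _ _ _ _ _ _ (hρ.refl a) (hρ.symm hab) hce (hρ.refl e)
    have h₂ : ρ (g a a e e) (g a b c e) :=
      hgρ _ _ _ _ _ _ _ _ (hρ.refl a) hab (hρ.symm hce) (hρ.refl e)
    rw [hfg] at h₁
    exact hρ.trans h₁ h₂
  | succ m ih =>
    obtain ⟨a', ha, h⟩ := hab
    obtain ⟨b', hab, hb⟩ := (altComp_odd_add_iff m 0 a' b).1 h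
    obtain ⟨c', hc, h⟩ := hce
    obtain ⟨e', hce, he⟩ := (altComp_odd_add_iff m 0 c' e).1 h
    exact ⟨f a' b' c' e', hfρ _ _ _ _ _ _ _ _ ha (hρ.symm hb) hc (hρ.symm he),
      (altComp_odd_add_iff m 0 _ _).2 ⟨g a' b' c' e', ih hσ hρ hfσ hgσ hfρ hgρ hab hce,
        hgρ _ _ _ _ _ _ _ _ (hρ.symm ha) hb (hρ.symm hc) he⟩⟩

theorem IsDistribSeq.altComp_of_altComp {A : Type*} {r : ℕ} (hr : 1 ≤ r)
    {d : ℕ → A → A → A → A → A} (hd : IsDistribSeq (2 * r) d) {α β γ : A → A → Prop}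
    (hα : Equivalence α) (hβ : Equivalence β) (hγ : Equivalence γ)
    (hcα : ∀ i ≤ 2 * r, Compat4 α (d i)) (hcβ : ∀ i ≤ 2 * r, Compat4 β (d i))
    (hcγ : ∀ i ≤ 2 * r, Compat4 γ (d i)) {m n : ℕ}
    (H : ∀ a e, α a e → AltComp β γ (2 * m + 1) a e → AltComp (RInter α β) γ (2 * n + 2) a e)
    {a e : A} (hae : α a e) (h : AltComp β γ (2 * m + 1 + (2 * m + 2)) a e) :
    AltComp (RInter α β) γ ((2 * n + 2) * r) a e := by
  obtain ⟨h₀, heven, heven', hodd, hlast⟩ := hd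
  obtain ⟨b, hab, c, hbc, hce⟩ := (altComp_odd_add_iff m (2 * m + 1) a e).1 h
  have step : ∀ j < r, AltComp (RInter α β) γ (2 * n + 2)
      (d (2 * j) a b c e) (d (2 * (j + 1)) a b c e) := by
    intro j hj
    have hα₁ : α (d (2 * j) a b c e) (d (2 * j) a b c a) :=
      hcα _ (by omega) _ _ _ _ _ _ _ _ (hα.refl a) (hα.refl b) (hα.refl c) (hα.symm hae)
    have hα₂ : α (d (2 * j + 1) a b c a) (d (2 * j + 1) a b c e) :=
      hcα _ (by omega) _ _ _ _ _ _ _ _ (hα.refl a) (hα.refl b) (hα.refl c) hae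
    rw [heven' _ (by omega) (even_two_mul j)] at hα₁
    have hγ₁ : γ (d (2 * j + 1) a b c e) (d (2 * j + 1) a b b e) :=
      hcγ _ (by omega) _ _ _ _ _ _ _ _ (hγ.refl a) (hγ.refl b) (hγ.symm hbc) (hγ.refl e)
    have hγ₂ : γ (d (2 * (j + 1)) a b b e) (d (2 * (j + 1)) a b c e) :=
      hcγ _ (by omega) _ _ _ _ _ _ _ _ (hγ.refl a) (hγ.refl b) hbc (hγ.refl e)
    rw [hodd _ (by omega) (odd_two_mul_add_one j)] at hγ₁
    exact (H _ _ (hα.trans hα₁ hα₂) (altComp_fold hβ hγ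
      (heven _ (by omega) (even_two_mul j)) (hcβ _ (by omega)) (hcβ _ (by omega))
      (hcγ _ (by omega)) (hcγ _ (by omega)) m hab hce)).even_trans_right hγ
      (hγ.trans hγ₁ hγ₂)
  have chain : ∀ j < r, AltComp (RInter α β) γ ((2 * n + 2) * (j + 1))
      a (d (2 * (j + 1)) a b c e) := by
    intro j hj
    induction j with
    | zero => simpa [h₀] using step 0 hj
    | succ j ih =>
      have h₁ := ih (by omega)
      rw [show (2 * n + 2) * (j + 1) = 2 * ((n + 1) * j + n) + 2 by ring] at h₁
      rw [show (2 * n + 2) * (j + 1 + 1) = 2 * ((n + 1) * j + n) + 2 + (2 * n + 1 + 1) by ring]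
      exact h₁.even_add (step (j + 1) hj)
  obtain ⟨s, rfl⟩ := Nat.exists_eq_add_of_le' hr
  simpa only [hlast] using chain s (Nat.lt_succ_self s)

/-- For `k = 2r` with `r ≥ 1` and a distributivity sequence of length `k`:
`α ∩ (β ∘_{2^ℓ − 1} γ) ⊆ (α ∩ β) ∘_{2·r^{ℓ−1}} γ` for every `ℓ ≥ 2`. -/
theorem stmt11 {A : Type*} (r : ℕ) (hr : 1 ≤ r) (d : ℕ → A → A → A → A → A)
    (hd : IsDistribSeq (2 * r) d) (α β γ : A → A → Prop)
    (hα : Equivalence α) (hβ : Equivalence β) (hγ : Equivalence γ)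
    (hcα : ∀ i ≤ 2 * r, Compat4 α (d i)) (hcβ : ∀ i ≤ 2 * r, Compat4 β (d i))
    (hcγ : ∀ i ≤ 2 * r, Compat4 γ (d i)) :
    ∀ ℓ, 2 ≤ ℓ → ∀ a e : A, α a e → AltComp β γ (2 ^ ℓ - 1) a e →
      AltComp (RInter α β) γ (2 * r ^ (ℓ - 1)) a e := by
  have key : ∀ ℓ, ∀ a e : A, α a e → AltComp β γ (2 ^ (ℓ + 1) - 1) a e →
      AltComp (RInter α β) γ (2 * r ^ ℓ) a e := by
    intro ℓ
    induction ℓ with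
    | zero => exact fun a e hae h => ⟨e, ⟨hae, h⟩, hγ.refl e⟩
    | succ ℓ ih =>
      intro a e hae h
      obtain ⟨m, hm⟩ := Nat.exists_eq_add_of_le' (Nat.one_le_two_pow (n := ℓ))
      obtain ⟨n, hn⟩ := Nat.exists_eq_add_of_le' (Nat.one_le_pow ℓ r hr)
      rw [show 2 ^ (ℓ + 1) - 1 = 2 * m + 1 by rw [pow_succ]; omega, hn] at ih
      rw [show 2 ^ (ℓ + 1 + 1) - 1 = 2 * m + 1 + (2 * m + 2) by
        rw [pow_succ, pow_succ]; omega] at h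
      rw [pow_succ, hn, ← mul_assoc]
      exact hd.altComp_of_altComp hr hα hβ hγ hcα hcβ hcγ ih hae h
  intro ℓ hℓ
  obtain ⟨s, rfl⟩ := Nat.exists_eq_add_of_le' (one_le_two.trans hℓ)
  exact key s
end

section
/- Let A be a type, let p ≥ 1, set k = 2^p, and let d₀, …, d_k : A⁴ → A be a distributivity sequence of length k. Let α, β, γ be equivalence relations on A, each compatible with every d_i. Then for every ℓ ≥ 2: α ∩ (β ∘_{2^ℓ − 1} γ) ⊆ (α ∩ β) ∘_{2^s + 1} (α ∩ γ), where s = (p−1)²·(ℓ−1) + 1. -/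
/-- The `j`-th relation in the alternating sequence `ρ, σ, ρ, σ, …`. -/
def altStep {A : Type*} (ρ σ : A → A → Prop) (j : ℕ) : A → A → Prop :=
  if Even j then ρ else σ

/-- A path of `n` alternating steps from `a` to `e`, starting with a `ρ`-step. -/
def AltPath {A : Type*} (ρ σ : A → A → Prop) (n : ℕ) (a e : A) : Prop :=
  ∃ c : ℕ → A, c 0 = a ∧ c n = e ∧ ∀ i < n, altStep ρ σ i (c i) (c (i + 1))

section AltPath

variable {A : Type*} {ρ σ : A → A → Prop}

theorem altStep_congr {i j : ℕ} (h : i % 2 = j % 2) : altStep ρ σ i = altStep ρ σ j := by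
  have : Even i ↔ Even j := by rw [Nat.even_iff, Nat.even_iff, h]
  simp only [altStep, this]

theorem altStep_swap (ρ σ : A → A → Prop) (i : ℕ) :
    altStep ρ σ (i + 1) = altStep σ ρ i := by
  by_cases h : Even i <;> simp [altStep, h, Nat.even_add_one]

theorem altStep_equivalence (hρ : Equivalence ρ) (hσ : Equivalence σ) (j : ℕ) :
    Equivalence (altStep ρ σ j) := by
  unfold altStep; split <;> assumption

theorem altStep_compat {f : A → A → A → A → A} (hρ : Compat4 ρ f) (hσ : Compat4 σ f) (j : ℕ) :
    Compat4 (altStep ρ σ j) f := by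
  unfold altStep; split <;> assumption

theorem AltPath.cons {n : ℕ} {a b e : A} (h : ρ a b) (hp : AltPath σ ρ n b e) :
    AltPath ρ σ (n + 1) a e := by
  obtain ⟨c, hc0, hcn, hc⟩ := hp
  refine ⟨fun i => Nat.casesOn i a c, rfl, hcn, ?_⟩
  rintro (_ | i) hi
  · simpa [altStep, hc0] using h
  · rw [altStep_swap]
    exact hc i (by omega)

theorem AltPath.uncons {n : ℕ} {a e : A} (hp : AltPath ρ σ (n + 1) a e) :
    ∃ b, ρ a b ∧ AltPath σ ρ n b e := by
  obtain ⟨c, hc0, hcn, hc⟩ := hp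
  refine ⟨c 1, ?_, fun i => c (i + 1), rfl, hcn, fun i hi => ?_⟩
  · simpa [altStep, hc0] using hc 0 (by omega)
  · rw [← altStep_swap]
    exact hc (i + 1) (by omega)

theorem altPath_zero {a e : A} : AltPath ρ σ 0 a e ↔ a = e :=
  ⟨fun ⟨_, h0, hn, _⟩ => h0.symm.trans hn, fun h => ⟨fun _ => a, rfl, h, by simp⟩⟩

theorem altComp_iff_altPath (ρ σ : A → A → Prop) (n : ℕ) (a e : A) :
    AltComp ρ σ (n + 1) a e ↔ AltPath ρ σ (n + 1) a e := by
  induction n generalizing ρ σ a with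
  | zero =>
    constructor
    · exact fun h => AltPath.cons h (altPath_zero.2 rfl)
    · intro h
      obtain ⟨b, hb, hp⟩ := h.uncons
      rw [altPath_zero] at hp
      exact hp ▸ hb
  | succ n ih =>
    constructor
    · rintro ⟨b, hb, hp⟩
      exact AltPath.cons hb ((ih _ _ _).1 hp)
    · intro h
      obtain ⟨b, hb, hp⟩ := h.uncons
      exact ⟨b, hb, (ih _ _ _).2 hp⟩

theorem AltPath.append {m n : ℕ} {a b e : A} (hm : Even m) (h₁ : AltPath ρ σ m a b)
    (h₂ : AltPath ρ σ n b e) : AltPath ρ σ (m + n) a e := by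
  obtain ⟨c, hc0, hcm, hc⟩ := h₁
  obtain ⟨c', hc0', hcn', hc'⟩ := h₂
  refine ⟨fun i => if i < m then c i else c' (i - m), ?_, ?_, fun i hi => ?_⟩
  · rcases Nat.eq_zero_or_pos m with rfl | h
    · simp [hc0', ← hcm, hc0]
    · simp [h, hc0]
  · simp [hcn']
  · dsimp only
    rcases lt_trichotomy (i + 1) m with h | h | h
    · rw [if_pos (by omega), if_pos h]
      exact hc i (by omega)
    · rw [if_pos (by omega), if_neg (by omega), h, Nat.sub_self, hc0', ← hcm, ← h]
      exact hc i (by omega)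
    · rw [if_neg (by omega), if_neg (by omega), Nat.sub_add_comm (by omega),
        altStep_congr (j := i - m) (by rw [Nat.even_iff] at hm; omega)]
      exact hc' (i - m) (by omega)

theorem AltPath.absorb_right (hσ : Equivalence σ) {n : ℕ} {a b e : A}
    (hn : Even n) (hn0 : 0 < n) (hp : AltPath ρ σ n a b) (h : σ b e) : AltPath ρ σ n a e := by
  obtain ⟨c, hc0, hcn, hc⟩ := hp
  refine ⟨fun i => if i < n then c i else e, by simp [hn0, hc0], by simp, fun i hi => ?_⟩
  dsimp only
  rw [if_pos hi]
  split_ifs with h'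
  · exact hc i hi
  · obtain rfl : n = i + 1 := by omega
    have hs := hc i hi
    have ho : ¬ Even i := by simpa [Nat.even_add_one] using hn
    simp only [altStep, ho, if_false] at hs ⊢
    exact hσ.trans hs (hcn ▸ h)

/-- If `f` and `g` agree on `(x, x, w, w)`, the values of `f` and `g` at the two ends and at the
two middle points of an alternating path are joined by an alternating path of half the length. -/
theorem altPath_fold (hρ : Equivalence ρ) (hσ : Equivalence σ) {f g : A → A → A → A → A}
    (hρf : Compat4 ρ f) (hσf : Compat4 σ f) (hρg : Compat4 ρ g) (hσg : Compat4 σ g)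
    (hfg : ∀ x w, f x x w w = g x x w w) {h : ℕ} {c : ℕ → A}
    (hc : ∀ i < 4 * h + 3, altStep ρ σ i (c i) (c (i + 1))) :
    AltPath ρ σ (2 * h + 1)
      (f (c 0) (c (2 * h + 1)) (c (2 * h + 2)) (c (4 * h + 3)))
      (g (c 0) (c (2 * h + 1)) (c (2 * h + 2)) (c (4 * h + 3))) := by
  have hE := altStep_equivalence hρ hσ
  have fwd (i j : ℕ) (hi : i < 4 * h + 3) (hij : i % 2 = j % 2) :
      altStep ρ σ j (c i) (c (i + 1)) := altStep_congr (ρ := ρ) (σ := σ) hij ▸ hc i hi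
  have fold {t : A → A → A → A → A} (ht : ∀ j, Compat4 (altStep ρ σ j) t) (j : ℕ) (hj : j < h) :
      altStep ρ σ j (t (c j) (c (2 * h + 1 - j)) (c (2 * h + 2 + j)) (c (4 * h + 3 - j)))
        (t (c (j + 1)) (c (2 * h + 1 - (j + 1))) (c (2 * h + 2 + (j + 1)))
          (c (4 * h + 3 - (j + 1)))) := by
    apply ht
    · exact fwd j j (by omega) rfl
    · have := fwd (2 * h + 1 - (j + 1)) j (by omega) (by omega)
      rw [show 2 * h + 1 - (j + 1) + 1 = 2 * h + 1 - j by omega] at this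
      exact (hE j).symm this
    · exact fwd (2 * h + 2 + j) j (by omega) (by omega)
    · have := fwd (4 * h + 3 - (j + 1)) j (by omega) (by omega)
      rw [show 4 * h + 3 - (j + 1) + 1 = 4 * h + 3 - j by omega] at this
      exact (hE j).symm this
  have middle {t : A → A → A → A → A} (ht : ∀ j, Compat4 (altStep ρ σ j) t) :
      altStep ρ σ h (t (c h) (c (2 * h + 1 - h)) (c (2 * h + 2 + h)) (c (4 * h + 3 - h)))
        (t (c h) (c h) (c (3 * h + 3)) (c (3 * h + 3))) := by
    rw [show 2 * h + 1 - h = h + 1 by omega, show 2 * h + 2 + h = 3 * h + 2 by omega,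
      show 4 * h + 3 - h = 3 * h + 3 by omega]
    exact ht _ _ _ _ _ _ _ _ _ ((hE h).refl _) ((hE h).symm (fwd h h (by omega) rfl))
      (fwd (3 * h + 2) h (by omega) (by omega)) ((hE h).refl _)
  let F (t : A → A → A → A → A) (j : ℕ) : A :=
    t (c j) (c (2 * h + 1 - j)) (c (2 * h + 2 + j)) (c (4 * h + 3 - j))
  refine ⟨fun j => if j ≤ h then F f j else F g (2 * h + 1 - j), by simp [F], ?_, fun j hj => ?_⟩
  · dsimp only
    rw [if_neg (by omega)]
    simp [F]
  · dsimp only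
    rcases lt_trichotomy j h with hjh | rfl | hjh
    · rw [if_pos hjh.le, if_pos (show j + 1 ≤ h by omega)]
      exact fold (altStep_compat hρf hσf) j hjh
    · rw [if_pos le_rfl, if_neg (by omega), show 2 * j + 1 - (j + 1) = j by omega]
      have hf := middle (altStep_compat hρf hσf)
      rw [hfg] at hf
      exact (hE j).trans hf ((hE j).symm (middle (altStep_compat hρg hσg)))
    · rw [if_neg (by omega), if_neg (by omega)]
      have := fold (altStep_compat hρg hσg) (2 * h + 1 - (j + 1)) (by omega)
      rw [altStep_congr (j := j) (by omega)] at this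
      rw [show 2 * h + 1 - j = 2 * h + 1 - (j + 1) + 1 by omega]
      exact (hE j).symm this

end AltPath

section Distributivity

variable {A : Type*} {α β γ : A → A → Prop}

theorem RInter.equivalence (hα : Equivalence α) (hβ : Equivalence β) :
    Equivalence (RInter α β) :=
  ⟨fun x => ⟨hα.refl x, hβ.refl x⟩, fun h => ⟨hα.symm h.1, hβ.symm h.2⟩,
    fun h h' => ⟨hα.trans h.1 h'.1, hβ.trans h.2 h'.2⟩⟩

theorem RInter.compat4 {f : A → A → A → A → A} (hα : Compat4 α f) (hβ : Compat4 β f) :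
    Compat4 (RInter α β) f :=
  fun _ _ _ _ _ _ _ _ h₁ h₂ h₃ h₄ =>
    ⟨hα _ _ _ _ _ _ _ _ h₁.1 h₂.1 h₃.1 h₄.1, hβ _ _ _ _ _ _ _ _ h₁.2 h₂.2 h₃.2 h₄.2⟩

/-- A distributivity sequence of length `2 ^ (q + 1)` gives
`α ∩ (β ∘_{2^(m+1) − 1} γ) ⊆ (α ∩ β) ∘_{2^(q m + 1)} γ`. -/
theorem IsDistribSeq.altPath_inter_left {q : ℕ} {d : ℕ → A → A → A → A → A}
    (hd : IsDistribSeq (2 ^ (q + 1)) d)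
    (hα : Equivalence α) (hβ : Equivalence β) (hγ : Equivalence γ)
    (hcα : ∀ i ≤ 2 ^ (q + 1), Compat4 α (d i)) (hcβ : ∀ i ≤ 2 ^ (q + 1), Compat4 β (d i))
    (hcγ : ∀ i ≤ 2 ^ (q + 1), Compat4 γ (d i)) (m : ℕ) (a e : A) (hae : α a e)
    (hp : AltPath β γ (2 ^ (m + 1) - 1) a e) :
    AltPath (RInter α β) γ (2 ^ (q * m + 1)) a e := by
  induction m generalizing a e with
  | zero =>
    obtain ⟨b, hb, hp⟩ := AltPath.uncons (n := 0) hp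
    rw [altPath_zero] at hp
    subst hp
    exact AltPath.cons ⟨hae, hb⟩ (AltPath.cons (hγ.refl b) (altPath_zero.2 rfl))
  | succ m ih =>
    obtain ⟨hd₀, hdβ, hdα, hdγ, hdk⟩ := hd
    obtain ⟨c, hc0, hcn, hc⟩ := hp
    obtain ⟨h, hh⟩ : ∃ h, 2 ^ m = h + 1 := ⟨2 ^ m - 1, by have := Nat.two_pow_pos m; omega⟩
    have hn : 2 ^ (m + 1 + 1) - 1 = 4 * h + 3 := by rw [pow_succ, pow_succ]; omega
    have hn' : 2 ^ (m + 1) - 1 = 2 * h + 1 := by rw [pow_succ]; omega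
    rw [hn] at hc hcn
    rw [hn'] at ih
    set b := c (2 * h + 1)
    set b' := c (2 * h + 2)
    have hk : 2 ^ (q + 1) = 2 * 2 ^ q := by rw [pow_succ]; ring
    have hbb : γ b b' := by
      have := hc (2 * h + 1) (by omega)
      rwa [altStep, if_neg (by simp)] at this
    have heven (t : ℕ) (ht : t < 2 ^ q) : AltPath (RInter α β) γ (2 ^ (q * m + 1))
        (d (2 * t) a b b' e) (d (2 * t + 1) a b b' e) := by
      apply ih
      · have h₁ := hcα (2 * t) (by omega) a b b' e a b b' a
          (hα.refl _) (hα.refl _) (hα.refl _) (hα.symm hae)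
        have h₂ := hcα (2 * t + 1) (by omega) a b b' e a b b' a
          (hα.refl _) (hα.refl _) (hα.refl _) (hα.symm hae)
        rw [hdα _ (by omega) (by simp)] at h₁
        exact hα.trans h₁ (hα.symm h₂)
      · rw [← hc0, ← hcn]
        exact altPath_fold hβ hγ (hcβ _ (by omega)) (hcγ _ (by omega)) (hcβ _ (by omega))
          (hcγ _ (by omega)) (hdβ _ (by omega) (by simp)) hc
    have hodd (t : ℕ) (ht : t < 2 ^ q) :
        γ (d (2 * t + 1) a b b' e) (d (2 * t + 2) a b b' e) := by
      have h₁ := hcγ (2 * t + 1) (by omega) a b b' e a b b e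
        (hγ.refl _) (hγ.refl _) (hγ.symm hbb) (hγ.refl _)
      have h₂ := hcγ (2 * t + 2) (by omega) a b b' e a b b e
        (hγ.refl _) (hγ.refl _) (hγ.symm hbb) (hγ.refl _)
      rw [hdγ _ (by omega) (by simp)] at h₁
      exact hγ.trans h₁ (hγ.symm h₂)
    have hr : Even (2 ^ (q * m + 1)) := by simp [Nat.even_pow]
    have hall (t : ℕ) (ht : t ≤ 2 ^ q) :
        AltPath (RInter α β) γ (t * 2 ^ (q * m + 1)) a (d (2 * t) a b b' e) := by
      induction t with
      | zero => simp [altPath_zero, hd₀]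
      | succ t iht =>
        rw [Nat.succ_mul]
        exact (iht (by omega)).append (hr.mul_left t)
          ((heven t (by omega)).absorb_right hγ hr (by positivity)
            (hodd t (by omega)))
    have := hall (2 ^ q) le_rfl
    rwa [← hk, hdk, ← pow_add, show q + (q * m + 1) = q * (m + 1) + 1 by ring] at this

end Distributivity

/-- For `k = 2^p` with `p ≥ 1` and a distributivity sequence of length `k`:
`α ∩ (β ∘_{2^ℓ − 1} γ) ⊆ (α ∩ β) ∘_{2^s + 1} (α ∩ γ)` for every `ℓ ≥ 2`,
where `s = (p−1)²·(ℓ−1) + 1`. -/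
theorem stmt12 {A : Type*} (p : ℕ) (hp : 1 ≤ p) (d : ℕ → A → A → A → A → A)
    (hd : IsDistribSeq (2 ^ p) d) (α β γ : A → A → Prop)
    (hα : Equivalence α) (hβ : Equivalence β) (hγ : Equivalence γ)
    (hcα : ∀ i ≤ 2 ^ p, Compat4 α (d i)) (hcβ : ∀ i ≤ 2 ^ p, Compat4 β (d i))
    (hcγ : ∀ i ≤ 2 ^ p, Compat4 γ (d i)) :
    ∀ ℓ, 2 ≤ ℓ → ∀ a e : A, α a e → AltComp β γ (2 ^ ℓ - 1) a e →
      AltComp (RInter α β) (RInter α γ)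
        (2 ^ ((p - 1) ^ 2 * (ℓ - 1) + 1) + 1) a e := by
  intro ℓ hℓ a e hae h
  obtain ⟨q, rfl⟩ : ∃ q, p = q + 1 := ⟨p - 1, by omega⟩
  obtain ⟨m, rfl⟩ : ∃ m, ℓ = m + 1 := ⟨ℓ - 1, by omega⟩
  have one_le (n : ℕ) : 1 ≤ 2 ^ (n + 1) - 1 := by
    have := Nat.two_pow_pos n
    rw [pow_succ]; omega
  rw [← Nat.sub_add_cancel (one_le m), altComp_iff_altPath, Nat.sub_add_cancel (one_le m)] at h
  have h₁ := hd.altPath_inter_left hα hβ hγ hcα hcβ hcγ m a e hae h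
  rw [← Nat.sub_add_cancel (Nat.one_le_two_pow (n := q * m + 1))] at h₁
  obtain ⟨b, hab, h₂⟩ := h₁.uncons
  have h₃ := hd.altPath_inter_left hα hγ (RInter.equivalence hα hβ) hcα hcγ
    (fun i hi => RInter.compat4 (hcα i hi) (hcβ i hi)) (q * m) b e
    (hα.trans (hα.symm hab.1) hae) h₂
  rw [altComp_iff_altPath, show (q + 1 - 1) ^ 2 * (m + 1 - 1) = q * (q * m) by
    simp only [Nat.add_sub_cancel]; ring]
  exact h₃.cons hab
end

section
/- Let A be a type, let p ≥ 1, set k = 2^p, and let d₀, …, d_k : A⁴ → A be a distributivity sequence of length k. Let α, β, γ be equivalence relations on A, each compatible with every d_i. Then α ∩ (β ∘ γ ∘ β) ⊆ (α ∩ β) ∘_{2^t + 1} (α ∩ γ), where t = (p−1)² + 1. -/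
/-- Powers of a binary relation under composition. -/
def RPow {A : Type*} (ρ : A → A → Prop) : ℕ → (A → A → Prop)
  | 0 => Eq
  | (n+1) => RComp ρ (RPow ρ n)

/-- The alternating composition `γ ∘ δ ∘ ⋯ ∘ γ` with `2 ^ (n + 1) - 1` factors. -/
def DyadicChain {A : Type*} (γ δ : A → A → Prop) : ℕ → (A → A → Prop)
  | 0 => γ
  | (n+1) => RComp (DyadicChain γ δ n) (RComp δ (DyadicChain γ δ n))

/-- The first half of `DyadicChain γ δ n`, which is this relation composed with its converse. -/
def DyadicHalf {A : Type*} (γ δ : A → A → Prop) : ℕ → (A → A → Prop)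
  | 0 => γ
  | (n+1) => RComp (DyadicChain γ δ n) δ

theorem RPow.append {A : Type*} {ρ : A → A → Prop} {m n : ℕ} {a b c : A}
    (hab : RPow ρ m a b) (hbc : RPow ρ n b c) : RPow ρ (m + n) a c := by
  induction m generalizing a with
  | zero =>
    obtain rfl : a = b := hab
    simpa using hbc
  | succ m ih =>
    obtain ⟨x, hax, hxb⟩ := hab
    rw [Nat.add_right_comm]
    exact ⟨x, hax, ih hxb⟩

theorem RPow.expand {A : Type*} {ρ σ : A → A → Prop} {m n : ℕ} {a b : A}
    (h : ∀ x y, ρ x y → RPow σ m x y) (hab : RPow ρ n a b) : RPow σ (n * m) a b := by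
  induction n generalizing a with
  | zero => rwa [Nat.zero_mul]
  | succ n ih =>
    obtain ⟨x, hax, hxb⟩ := hab
    rw [Nat.succ_mul, Nat.add_comm]
    exact (h _ _ hax).append (ih hxb)

theorem RPow.absorb_right {A : Type*} {ρ σ : A → A → Prop}
    (hσ : ∀ {x y z}, σ x y → σ y z → σ x z) {n : ℕ} (hn : 0 < n) {a b c : A}
    (hab : RPow (RComp ρ σ) n a b) (hbc : σ b c) : RPow (RComp ρ σ) n a c := by
  induction n generalizing a with
  | zero => omega
  | succ n ih =>
    obtain ⟨x, ⟨y, hay, hyx⟩, hxb⟩ := hab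
    rcases Nat.eq_zero_or_pos n with rfl | hn
    · obtain rfl : x = b := hxb
      exact ⟨c, ⟨y, hay, hσ hyx hbc⟩, rfl⟩
    · exact ⟨x, ⟨y, hay, hyx⟩, ih hn hxb⟩

theorem RPow.of_even_steps {A : Type*} {ρ : A → A → Prop} {x : ℕ → A} {n : ℕ}
    (h : ∀ i < n, ρ (x (2 * i)) (x (2 * i + 2))) : RPow ρ n (x 0) (x (2 * n)) := by
  induction n with
  | zero => rfl
  | succ n ih =>
    exact (ih fun i hi => h i (by omega)).append (n := 1) ⟨_, h n (by omega), rfl⟩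

theorem AltComp.of_rPow {A : Type*} {ρ σ : A → A → Prop} {n : ℕ} {a b c : A}
    (hab : ρ a b) (hbc : RPow (RComp σ ρ) n b c) : AltComp ρ σ (2 * n + 1) a c := by
  induction n generalizing a b with
  | zero =>
    obtain rfl : b = c := hbc
    exact hab
  | succ n ih =>
    obtain ⟨x, ⟨y, hby, hyx⟩, hxc⟩ := hbc
    exact ⟨b, hab, y, hby, ih hyx hxc⟩

theorem Compat4.rComp {A : Type*} {ρ σ : A → A → Prop} {f : A → A → A → A → A}
    (hρ : Compat4 ρ f) (hσ : Compat4 σ f) : Compat4 (RComp ρ σ) f := by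
  rintro _ _ _ _ _ _ _ _ ⟨x₁, p₁, q₁⟩ ⟨x₂, p₂, q₂⟩ ⟨x₃, p₃, q₃⟩ ⟨x₄, p₄, q₄⟩
  exact ⟨f x₁ x₂ x₃ x₄, hρ _ _ _ _ _ _ _ _ p₁ p₂ p₃ p₄, hσ _ _ _ _ _ _ _ _ q₁ q₂ q₃ q₄⟩

theorem Compat4.rInter {A : Type*} {ρ σ : A → A → Prop} {f : A → A → A → A → A}
    (hρ : Compat4 ρ f) (hσ : Compat4 σ f) : Compat4 (RInter ρ σ) f :=
  fun _ _ _ _ _ _ _ _ h₁ h₂ h₃ h₄ =>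
    ⟨hρ _ _ _ _ _ _ _ _ h₁.1 h₂.1 h₃.1 h₄.1, hσ _ _ _ _ _ _ _ _ h₁.2 h₂.2 h₃.2 h₄.2⟩

theorem Equivalence.rInter {A : Type*} {ρ σ : A → A → Prop}
    (hρ : Equivalence ρ) (hσ : Equivalence σ) : Equivalence (RInter ρ σ) :=
  ⟨fun x => ⟨hρ.refl x, hσ.refl x⟩, fun h => ⟨hρ.symm h.1, hσ.symm h.2⟩,
    fun h h' => ⟨hρ.trans h.1 h'.1, hσ.trans h.2 h'.2⟩⟩

theorem DyadicChain.compat4 {A : Type*} {γ δ : A → A → Prop} {f : A → A → A → A → A}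
    (hγ : Compat4 γ f) (hδ : Compat4 δ f) : ∀ n, Compat4 (DyadicChain γ δ n) f
  | 0 => hγ
  | (n+1) => (DyadicChain.compat4 hγ hδ n).rComp (hδ.rComp (DyadicChain.compat4 hγ hδ n))

theorem DyadicHalf.compat4 {A : Type*} {γ δ : A → A → Prop} {f : A → A → A → A → A}
    (hγ : Compat4 γ f) (hδ : Compat4 δ f) : ∀ n, Compat4 (DyadicHalf γ δ n) f
  | 0 => hγ
  | (n+1) => (DyadicChain.compat4 hγ hδ n).rComp hδ

theorem DyadicChain.symm {A : Type*} {γ δ : A → A → Prop}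
    (hγ : Equivalence γ) (hδ : Equivalence δ) {n : ℕ} {a b : A}
    (h : DyadicChain γ δ n a b) : DyadicChain γ δ n b a := by
  induction n generalizing a b with
  | zero => exact hγ.symm h
  | succ n ih =>
    obtain ⟨x, hax, y, hxy, hyb⟩ := h
    exact ⟨y, ih hyb, x, hδ.symm hxy, ih hax⟩

theorem DyadicChain.iff_half {A : Type*} {γ δ : A → A → Prop}
    (hγ : Equivalence γ) (hδ : Equivalence δ) {n : ℕ} {a b : A} :
    DyadicChain γ δ n a b ↔ ∃ s, DyadicHalf γ δ n a s ∧ DyadicHalf γ δ n b s := by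
  cases n with
  | zero => exact ⟨fun h => ⟨b, h, hγ.refl b⟩, fun ⟨_, h, h'⟩ => hγ.trans h (hγ.symm h')⟩
  | succ n =>
    constructor
    · rintro ⟨x, hax, y, hxy, hyb⟩
      exact ⟨y, ⟨x, hax, hxy⟩, y, hyb.symm hγ hδ, hδ.refl y⟩
    · rintro ⟨s, ⟨x, hax, hxs⟩, y, hby, hys⟩
      exact ⟨x, hax, y, hδ.trans hxs (hδ.symm hys), hby.symm hγ hδ⟩

theorem DyadicChain.of_alternating {A : Type*} {γ δ : A → A → Prop} {x : ℕ → A} {k : ℕ}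
    (hγ : ∀ i < k, Odd i → γ (x i) (x (i + 1))) (hδ : ∀ i < k, Even i → δ (x i) (x (i + 1)))
    (n : ℕ) {i j : ℕ} (hi : Odd i) (hij : i + 2 ^ (n + 1) = j + 1) (hj : j ≤ k) :
    DyadicChain γ δ n (x i) (x j) := by
  induction n generalizing i j with
  | zero =>
    obtain rfl : j = i + 1 := by omega
    exact hγ i (by omega) hi
  | succ n ih =>
    rw [pow_succ] at hij
    have hpos : 0 < 2 ^ (n + 1) := by positivity
    have heven : Even (2 ^ (n + 1)) := by simp [pow_succ]
    obtain ⟨m, hm⟩ : ∃ m, i + 2 ^ (n + 1) = m + 1 := ⟨i + 2 ^ (n + 1) - 1, by omega⟩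
    have hmodd : Odd (m + 1) := hm ▸ hi.add_even heven
    refine ⟨x m, ih hi hm (by omega), x (m + 1), hδ m (by omega) ?_, ih hmodd (by omega) hj⟩
    rwa [Nat.odd_add_one, Nat.not_odd_iff_even] at hmodd

/-- If `b` and `c` are `α`-related, all the values `d i a b c e` are `α`-related to `a`. -/
theorem IsDistribSeq.rel_left {A : Type*} {k : ℕ} {d : ℕ → A → A → A → A → A}
    (hd : IsDistribSeq k d) {α : A → A → Prop} (hα : Equivalence α)
    (hcα : ∀ i ≤ k, Compat4 α (d i)) {a b c e : A} (hae : α a e) (hbc : α b c) :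
    ∀ i ≤ k, α a (d i a b c e) := by
  obtain ⟨h0, -, heven, hodd, -⟩ := hd
  intro i
  induction i with
  | zero => intro _; rw [h0]; exact hα.refl a
  | succ i ih =>
    intro hi
    refine hα.trans (ih (by omega)) ?_
    rcases Nat.even_or_odd i with hp | hp
    · have h := heven i (by omega) hp a b c
      refine hα.trans (hcα i (by omega) a b c e a b c a
        (hα.refl _) (hα.refl _) (hα.refl _) (hα.symm hae)) ?_
      rw [h]
      exact hcα (i + 1) hi _ _ _ _ _ _ _ _ (hα.refl _) (hα.refl _) (hα.refl _) hae
    · have h := hodd i (by omega) hp a b e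
      refine hα.trans (hcα i (by omega) a b c e a b b e
        (hα.refl _) (hα.refl _) (hα.symm hbc) (hα.refl _)) ?_
      rw [h]
      exact hcα (i + 1) hi _ _ _ _ _ _ _ _ (hα.refl _) (hα.refl _) hbc (hα.refl _)

theorem IsDistribSeq.rel_succ_of_odd {A : Type*} {k : ℕ} {d : ℕ → A → A → A → A → A}
    (hd : IsDistribSeq k d) {θ : A → A → Prop} (hθ : Equivalence θ)
    (hcθ : ∀ i ≤ k, Compat4 θ (d i)) {a b c e : A} (hbc : θ b c) {i : ℕ} (hi : i < k)
    (hp : Odd i) : θ (d i a b c e) (d (i + 1) a b c e) := by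
  have h := hd.2.2.2.1 i hi hp a b e
  refine hθ.trans (hcθ i hi.le a b c e a b b e
    (hθ.refl _) (hθ.refl _) (hθ.symm hbc) (hθ.refl _)) ?_
  rw [h]
  exact hcθ (i + 1) hi _ _ _ _ _ _ _ _ (hθ.refl _) (hθ.refl _) hbc (hθ.refl _)

theorem DyadicChain.rPow_of_succ {A : Type*} {h : ℕ} {d : ℕ → A → A → A → A → A}
    (hd : IsDistribSeq (2 * h) d) {α γ δ : A → A → Prop}
    (hα : Equivalence α) (hγ : Equivalence γ) (hδ : Equivalence δ)
    (hcα : ∀ i ≤ 2 * h, Compat4 α (d i)) (hcγ : ∀ i ≤ 2 * h, Compat4 γ (d i))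
    (hcδ : ∀ i ≤ 2 * h, Compat4 δ (d i)) (hδα : ∀ {x y}, δ x y → α x y)
    {n : ℕ} {a e : A} (hae : α a e) (hch : DyadicChain γ δ (n + 1) a e) :
    RPow (RComp (RInter α (DyadicChain γ δ n)) δ) h a e := by
  obtain ⟨b, hab, c, hbc, hce⟩ := hch
  obtain ⟨s, has, hbs⟩ := (DyadicChain.iff_half hγ hδ).1 hab
  obtain ⟨t, hct, het⟩ := (DyadicChain.iff_half hγ hδ).1 hce
  have hrel := hd.rel_left hα hcα hae (hδα hbc)
  have hmid : ∀ i ≤ 2 * h, DyadicHalf γ δ n (d i a b c e) (d i s s t t) := fun i hi =>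
    DyadicHalf.compat4 (hcγ i hi) (hcδ i hi) n _ _ _ _ _ _ _ _ has hbs hct het
  have key := RPow.of_even_steps (ρ := RComp (RInter α (DyadicChain γ δ n)) δ)
    (x := fun i => d i a b c e) (n := h) fun i hi =>
      ⟨d (2 * i + 1) a b c e,
        ⟨hα.trans (hα.symm (hrel _ (by omega))) (hrel _ (by omega)),
          (DyadicChain.iff_half hγ hδ).2 ⟨d (2 * i) s s t t, hmid _ (by omega), by
            rw [hd.2.1 (2 * i) (by omega) (even_two_mul i)]
            exact hmid _ (by omega)⟩⟩,
        hd.rel_succ_of_odd hδ hcδ hbc (by omega) (odd_two_mul_add_one i)⟩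
  simpa only [hd.1, hd.2.2.2.2] using key

theorem DyadicChain.rPow {A : Type*} {h : ℕ} (hpos : 0 < h) {d : ℕ → A → A → A → A → A}
    (hd : IsDistribSeq (2 * h) d) {α γ δ : A → A → Prop}
    (hα : Equivalence α) (hγ : Equivalence γ) (hδ : Equivalence δ)
    (hcα : ∀ i ≤ 2 * h, Compat4 α (d i)) (hcγ : ∀ i ≤ 2 * h, Compat4 γ (d i))
    (hcδ : ∀ i ≤ 2 * h, Compat4 δ (d i)) (hδα : ∀ {x y}, δ x y → α x y)
    (n : ℕ) {a e : A} (hae : α a e) (hch : DyadicChain γ δ n a e) :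
    RPow (RComp (RInter α γ) δ) (h ^ n) a e := by
  induction n generalizing a e with
  | zero => exact ⟨e, ⟨e, ⟨hae, hch⟩, hδ.refl e⟩, rfl⟩
  | succ n ih =>
    rw [pow_succ, Nat.mul_comm]
    refine (rPow_of_succ hd hα hγ hδ hcα hcγ hcδ hδα hae hch).expand ?_
    rintro x z ⟨y, ⟨hxy, hxy'⟩, hyz⟩
    exact (ih hxy hxy').absorb_right (σ := δ) hδ.trans (Nat.pow_pos hpos) hyz

/-- For `k = 2^p` with `p ≥ 1` and a distributivity sequence of length `k`:
`α ∩ (β ∘ γ ∘ β) ⊆ (α ∩ β) ∘_{2^t + 1} (α ∩ γ)`, where `t = (p−1)² + 1`. -/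
theorem stmt13 {A : Type*} (p : ℕ) (hp : 1 ≤ p) (d : ℕ → A → A → A → A → A)
    (hd : IsDistribSeq (2 ^ p) d) (α β γ : A → A → Prop)
    (hα : Equivalence α) (hβ : Equivalence β) (hγ : Equivalence γ)
    (hcα : ∀ i ≤ 2 ^ p, Compat4 α (d i)) (hcβ : ∀ i ≤ 2 ^ p, Compat4 β (d i))
    (hcγ : ∀ i ≤ 2 ^ p, Compat4 γ (d i)) :
    ∀ a e : A, α a e → RComp β (RComp γ β) a e →
      AltComp (RInter α β) (RInter α γ) (2 ^ ((p - 1) ^ 2 + 1) + 1) a e := by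
  rintro a e hae ⟨b, hab, c, hbc, hce⟩
  obtain ⟨q, rfl⟩ : ∃ q, p = q + 1 := ⟨p - 1, by omega⟩
  have hpow : 2 ^ (q + 1) = 2 * 2 ^ q := by ring
  have hδ : Equivalence (RInter α β) := hα.rInter hβ
  have heven : ∀ i < 2 ^ (q + 1), Even i →
      RInter α β (d i a b c e) (d (i + 1) a b c e) := by
    intro i hi hp
    constructor
    · have h := hd.2.2.1 i hi hp a b c
      refine hα.trans (hcα i hi.le a b c e a b c a
        (hα.refl _) (hα.refl _) (hα.refl _) (hα.symm hae)) ?_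
      rw [h]
      exact hcα (i + 1) hi _ _ _ _ _ _ _ _ (hα.refl _) (hα.refl _) (hα.refl _) hae
    · have h := hd.2.1 i hi hp a e
      refine hβ.trans (hcβ i hi.le a b c e a a e e
        (hβ.refl _) (hβ.symm hab) hce (hβ.refl _)) ?_
      rw [h]
      exact hcβ (i + 1) hi _ _ _ _ _ _ _ _ (hβ.refl _) hab (hβ.symm hce) (hβ.refl _)
  have hodd : ∀ i < 2 ^ (q + 1), Odd i → γ (d i a b c e) (d (i + 1) a b c e) :=
    fun i hi hp => hd.rel_succ_of_odd hγ hcγ hbc hi hp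
  have hfirst : RInter α β a (d 1 a b c e) := by
    simpa only [hd.1] using heven 0 (by positivity) Even.zero
  have hchain : DyadicChain γ (RInter α β) q (d 1 a b c e) e := by
    simpa only [hd.2.2.2.2] using
      DyadicChain.of_alternating (x := fun i => d i a b c e) hodd heven q odd_one
        (Nat.add_comm _ _) le_rfl
  rw [hpow] at hd hcα hcβ hcγ
  have key := AltComp.of_rPow hfirst
    (DyadicChain.rPow (by positivity) hd hα hγ hδ hcα hcγ
      (fun i hi => (hcα i hi).rInter (hcβ i hi)) And.left q
      (hα.trans (hα.symm hfirst.1) hae) hchain)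
  have hexp : 2 ^ ((q + 1 - 1) ^ 2 + 1) + 1 = 2 * (2 ^ q) ^ q + 1 := by
    rw [Nat.add_sub_cancel, ← pow_mul, pow_succ, sq, Nat.mul_comm]
  rw [hexp]
  exact key
end
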